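/- Let V : ℝ → ℝ be continuously differentiable with V(r) = 0 for r ≥ 1 and V′(0) = 0, so that W : ℝ² → ℝ defined by W(y) := V(‖y‖) is continuously differentiable with compact support. Let 𝓕W denote the Fourier transform of W on ℝ² with the convention 𝓕W(ξ) = ∫_{ℝ²} W(x) e^{−2πi⟨x,ξ⟩} dx, and let ρ > 0. Then (ρ/2) ∫_{−1}^{1} (2 ∫_{|b|}^{1} V′(|b|/u) (b/u) du/√(1 − u²))² db = 2π² ρ ∫_ℝ k² ‖𝓕W((0, k))‖² dk. -/

import Mathlib

open scoped FourierTransform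

/-- The point of `ℝ²` with coordinates `a`, `b`. -/
noncomputable def vec2 (a b : ℝ) : EuclideanSpace ℝ (Fin 2) :=
  (EuclideanSpace.equiv (Fin 2) ℝ).symm ![a, b]

section Auxiliary

open MeasureTheory Set FourierTransform

open scoped ContDiff

/-- On `L¹ ∩ L²`, the integral Fourier transform represents the `L²` Fourier transform. -/
theorem MeasureTheory.MemLp.coeFn_fourier_toLp {f : ℝ → ℂ} (hf : Integrable f)
    (hf2 : MemLp f 2) : (𝓕 (hf2.toLp f) : Lp ℂ 2 (volume : Measure ℝ)) =ᵐ[volume] 𝓕 f := by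
  have hcont : Continuous (𝓕 f) :=
    VectorFourier.fourierIntegral_continuous Real.continuous_fourierChar
      (by fun_prop) hf
  refine ae_eq_of_integral_contDiff_smul_eq ((Lp.memLp _).locallyIntegrable (by norm_num))
    hcont.locallyIntegrable fun g hg hgc ↦ ?_
  have hg₁ : HasCompactSupport (Complex.ofRealCLM ∘ g) := hgc.comp_left rfl
  have hg₂ : ContDiff ℝ ∞ (Complex.ofRealCLM ∘ g) := by fun_prop
  set φ : SchwartzMap ℝ ℂ := hg₁.toSchwartzMap hg₂ with hφ
  have hφg (x : ℝ) : φ x = (g x : ℂ) := rfl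
  calc ∫ x, g x • (𝓕 (hf2.toLp f) : Lp ℂ 2 (volume : Measure ℝ)) x
      = ((𝓕 (hf2.toLp f) : Lp ℂ 2 (volume : Measure ℝ)) : TemperedDistribution ℝ ℂ) φ := by
        simp [Lp.toTemperedDistribution_apply, hφg]
    _ = ∫ x, (𝓕 φ) x • (hf2.toLp f) x := by
        rw [← Lp.fourier_toTemperedDistribution_eq, TemperedDistribution.fourier_apply,
          Lp.toTemperedDistribution_apply]
    _ = ∫ x, (𝓕 (φ : ℝ → ℂ)) x • f x := by
        refine integral_congr_ae ?_
        filter_upwards [hf2.coeFn_toLp] with x hx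
        rw [hx, SchwartzMap.fourier_coe]
    _ = ∫ x, φ x • 𝓕 f x := by
        have := VectorFourier.integral_fourierIntegral_smul_eq_flip (L := innerₗ ℝ)
          Real.continuous_fourierChar continuous_inner φ.integrable hf (μ := volume) (ν := volume)
        rwa [flip_innerₗ] at this
    _ = ∫ x, g x • 𝓕 f x := by simp [hφg]

/-- Plancherel's theorem for functions in `L¹ ∩ L²`. -/
theorem MeasureTheory.Integrable.integral_norm_sq_fourier {f : ℝ → ℂ} (hf : Integrable f)
    (hf2 : MemLp f 2) : ∫ k, ‖𝓕 f k‖ ^ 2 = ∫ x, ‖f x‖ ^ 2 := by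
  have key (g : Lp ℂ 2 (volume : Measure ℝ)) :
      ((‖g‖ ^ 2 : ℝ) : ℂ) = ((∫ x, ‖g x‖ ^ 2 : ℝ) : ℂ) := by
    rw [← integral_complex_ofReal]
    have := inner_self_eq_norm_sq_to_K (𝕜 := ℂ) g
    rw [L2.inner_def] at this
    simp only [inner_self_eq_norm_sq_to_K] at this
    simpa using this.symm
  have h1 := Complex.ofReal_injective (key (hf2.toLp f))
  have h2 := Complex.ofReal_injective (key (𝓕 (hf2.toLp f)))
  rw [Lp.norm_fourier_eq, h1] at h2
  have e1 := integral_congr_ae (hf2.coeFn_toLp.fun_comp fun z : ℂ ↦ ‖z‖ ^ 2)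
  have e2 := integral_congr_ae ((hf2.coeFn_fourier_toLp hf).fun_comp fun z : ℂ ↦ ‖z‖ ^ 2)
  exact e2.symm.trans (h2.symm.trans e1)

theorem measurePreserving_vec2 :
    MeasurePreserving (fun p : ℝ × ℝ ↦ vec2 p.1 p.2) :=
  (PiLp.volume_preserving_toLp (Fin 2)).comp (volume_preserving_finTwoArrow ℝ).symm

theorem measurableEmbedding_vec2 :
    MeasurableEmbedding (fun p : ℝ × ℝ ↦ vec2 p.1 p.2) :=
  (MeasurableEquiv.toLp 2 (Fin 2 → ℝ)).measurableEmbedding.comp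
    (MeasurableEquiv.finTwoArrow (α := ℝ)).symm.measurableEmbedding

theorem norm_vec2 (a b : ℝ) : ‖vec2 a b‖ = √(a ^ 2 + b ^ 2) := by
  simp [vec2, EuclideanSpace.norm_eq, Fin.sum_univ_two]

/-- Projection-slice theorem: restricting the Fourier transform to the second axis amounts to
integrating out the first variable. -/
theorem fourier_vec2_zero {W : EuclideanSpace ℝ (Fin 2) → ℂ} (hW : Integrable W) (k : ℝ) :
    𝓕 W (vec2 0 k) = 𝓕 (fun b ↦ ∫ a, W (vec2 a b)) k := by
  have hW' : Integrable (fun y ↦ Real.fourierChar (-inner ℝ y (vec2 0 k)) • W y) :=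
    (Real.fourierIntegral_convergent_iff (vec2 0 k)).2 hW
  have hprod : Integrable (fun p : ℝ × ℝ ↦
      Real.fourierChar (-inner ℝ (vec2 p.1 p.2) (vec2 0 k)) • W (vec2 p.1 p.2)) :=
    (measurePreserving_vec2.integrable_comp_emb measurableEmbedding_vec2).2 hW'
  rw [Real.fourier_eq, Real.fourier_eq,
    ← measurePreserving_vec2.integral_comp measurableEmbedding_vec2]
  rw [Measure.volume_eq_prod] at hprod ⊢
  rw [integral_prod_symm _ hprod]
  congr with b
  rw [Circle.smul_def, ← integral_smul]
  congr with a
  rw [Circle.smul_def]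
  simp [vec2, PiLp.inner_apply, Fin.sum_univ_two]

/-- The substitution `u = |b| / √(x² + b²)`. -/
theorem integral_abs_div_substitution {h : ℝ → ℝ} (hh : ∀ r, 1 ≤ r → h r = 0) {b : ℝ}
    (hb : b ≠ 0) (hb1 : |b| ≤ 1) :
    ∫ u in |b|..1, h (|b| / u) * (b / u) / √(1 - u ^ 2)
      = ∫ x in Ioi 0, h √(x ^ 2 + b ^ 2) * (b / √(x ^ 2 + b ^ 2)) := by
  have hb0 : 0 < |b| := abs_pos.2 hb
  have hpos (x : ℝ) : 0 < x ^ 2 + b ^ 2 := by positivity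
  have himage : (fun x ↦ |b| / √(x ^ 2 + b ^ 2)) '' Ioi 0 = Ioo 0 1 := by
    ext u
    constructor
    · rintro ⟨x, hx, rfl⟩
      have hx : 0 < x := hx
      refine ⟨div_pos hb0 (Real.sqrt_pos.2 (hpos x)), ?_⟩
      rw [div_lt_one (Real.sqrt_pos.2 (hpos x)), ← Real.sqrt_sq_eq_abs]
      exact Real.sqrt_lt_sqrt (sq_nonneg b) (by nlinarith)
    · rintro ⟨hu0, hu1⟩
      have hlt : 0 < (b / u) ^ 2 - b ^ 2 := by
        have : (b / u) ^ 2 - b ^ 2 = b ^ 2 * (1 - u ^ 2) / u ^ 2 := by field_simp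
        rw [this]
        have : 0 < 1 - u ^ 2 := by nlinarith
        positivity
      refine ⟨√((b / u) ^ 2 - b ^ 2), Real.sqrt_pos.2 hlt, ?_⟩
      simp only
      rw [Real.sq_sqrt hlt.le, sub_add_cancel, Real.sqrt_sq_eq_abs, abs_div, abs_of_pos hu0]
      field_simp
  have hinj : InjOn (fun x ↦ |b| / √(x ^ 2 + b ^ 2)) (Ioi 0) := by
    intro x (hx : 0 < x) y (hy : 0 < y) hxy
    have h1 : √(x ^ 2 + b ^ 2) = √(y ^ 2 + b ^ 2) := by
      simpa [div_eq_mul_inv, hb] using hxy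
    rw [Real.sqrt_inj (hpos x).le (hpos y).le, add_left_inj] at h1
    exact (sq_eq_sq₀ hx.le hy.le).1 h1
  have hderiv (x : ℝ) (_ : x ∈ Ioi (0 : ℝ)) : HasDerivWithinAt (fun x ↦ |b| / √(x ^ 2 + b ^ 2))
      (-(|b| * x / √(x ^ 2 + b ^ 2) ^ 3)) (Ioi 0) x := by
    have h1 := (((hasDerivAt_pow 2 x).add_const (b ^ 2)).sqrt (hpos x).ne')
    have h2 := ((hasDerivAt_const x |b|).fun_div h1
      (Real.sqrt_pos.2 (hpos x)).ne').hasDerivWithinAt (s := Ioi 0)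
    refine h2.congr_deriv ?_
    have := Real.sqrt_pos.2 (hpos x)
    field_simp
    push_cast
    ring
  calc ∫ u in |b|..1, h (|b| / u) * (b / u) / √(1 - u ^ 2)
      = ∫ u in Ioo |b| 1, h (|b| / u) * (b / u) / √(1 - u ^ 2) := by
        rw [intervalIntegral.integral_of_le hb1, integral_Ioc_eq_integral_Ioo]
    _ = ∫ u in Ioo 0 1, h (|b| / u) * (b / u) / √(1 - u ^ 2) := by
        symm
        refine setIntegral_eq_of_subset_of_forall_sdiff_eq_zero measurableSet_Ioo
          (Ioo_subset_Ioo_left hb0.le) fun u hu ↦ ?_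
        have hub : u ≤ |b| := by
          by_contra! hlt
          exact hu.2 ⟨hlt, hu.1.2⟩
        rw [hh _ ((one_le_div hu.1.1).2 hub)]
        simp
    _ = _ := by
        rw [← himage, integral_image_eq_integral_abs_deriv_smul measurableSet_Ioi hderiv hinj]
        refine setIntegral_congr_fun measurableSet_Ioi fun x (hx : 0 < x) ↦ ?_
        have hr := Real.sqrt_pos.2 (hpos x)
        have hr2 := Real.sq_sqrt (hpos x).le
        set r := √(x ^ 2 + b ^ 2)
        have h1 : √(1 - (|b| / r) ^ 2) = x / r := by
          rw [← Real.sqrt_sq (div_pos hx hr).le]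
          congr 1
          rw [div_pow, div_pow, sq_abs, hr2]
          field_simp [(hpos x).ne']
          ring
        have h2 : |b| / (|b| / r) = r := by field_simp
        simp only [smul_eq_mul]
        rw [h1, h2, abs_neg, abs_of_pos (by positivity)]
        field_simp

section RadialSlice

variable {V : ℝ → ℝ}

theorem deriv_eq_zero_of_forall_ge_eq_zero (hV : Differentiable ℝ V) {a : ℝ}
    (hVsupp : ∀ r, a ≤ r → V r = 0) {r : ℝ} (hr : a ≤ r) : deriv V r = 0 := by
  have hu := uniqueDiffOn_Ici r r self_mem_Ici
  rw [← (hV r).derivWithin hu, derivWithin_congr (f := fun _ ↦ 0) (s := Ici r)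
    (fun x hx ↦ hVsupp x (hr.trans hx)) (hVsupp r hr)]
  simp

theorem one_lt_sqrt_sq_add_sq_left {x b : ℝ} (hx : 1 < |x|) : 1 < √(x ^ 2 + b ^ 2) := by
  refine hx.trans_le ?_
  rw [← Real.sqrt_sq_eq_abs]
  exact Real.sqrt_le_sqrt (by nlinarith [sq_nonneg b])

theorem one_lt_sqrt_sq_add_sq_right {x b : ℝ} (hb : 1 < |b|) : 1 < √(x ^ 2 + b ^ 2) :=
  add_comm (x ^ 2) (b ^ 2) ▸ one_lt_sqrt_sq_add_sq_left hb

theorem integrable_radial (hV : Continuous V) (hVsupp : ∀ r, 1 ≤ r → V r = 0) :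
    Integrable (fun y : EuclideanSpace ℝ (Fin 2) ↦ (V ‖y‖ : ℂ)) := by
  refine Continuous.integrable_of_hasCompactSupport (by fun_prop) ?_
  refine HasCompactSupport.intro (isCompact_closedBall 0 1) fun y hy ↦ ?_
  rw [mem_closedBall_zero_iff, not_le] at hy
  simp [hVsupp _ hy.le]

theorem integrable_radial_line (hV : Continuous V) (hVsupp : ∀ r, 1 ≤ r → V r = 0) (b : ℝ) :
    Integrable (fun x : ℝ ↦ (V √(x ^ 2 + b ^ 2) : ℂ)) := by
  refine Continuous.integrable_of_hasCompactSupport (by fun_prop) ?_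
  refine HasCompactSupport.intro (isCompact_Icc (a := (-1 : ℝ)) (b := 1)) fun x hx ↦ ?_
  rw [mem_Icc, ← abs_le, not_le] at hx
  simp [hVsupp _ (one_lt_sqrt_sq_add_sq_left hx).le]

theorem norm_radial_deriv_le {h : ℝ → ℝ} {M : ℝ} (hh : ∀ r, 1 ≤ r → h r = 0)
    (hM : ∀ r ∈ Icc (0 : ℝ) 1, ‖h r‖ ≤ M) (x b : ℝ) :
    ‖h √(x ^ 2 + b ^ 2) * (b / √(x ^ 2 + b ^ 2))‖
      ≤ (Icc (-1 : ℝ) 1).indicator (fun _ ↦ M) x := by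
  have hM0 : 0 ≤ M := (norm_nonneg _).trans (hM 0 (by simp))
  by_cases hx : x ∈ Icc (-1 : ℝ) 1
  · rw [indicator_of_mem hx, norm_mul]
    have h1 : ‖b / √(x ^ 2 + b ^ 2)‖ ≤ 1 := by
      rw [norm_div, Real.norm_of_nonneg (Real.sqrt_nonneg _)]
      refine div_le_one_of_le₀ ?_ (Real.sqrt_nonneg _)
      exact Real.abs_le_sqrt (by nlinarith [sq_nonneg x])
    have h2 : ‖h √(x ^ 2 + b ^ 2)‖ ≤ M := by
      rcases le_total 1 √(x ^ 2 + b ^ 2) with hr | hr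
      · simpa [hh _ hr] using hM0
      · exact hM _ ⟨Real.sqrt_nonneg _, hr⟩
    calc _ ≤ M * 1 := mul_le_mul h2 h1 (norm_nonneg _) hM0
      _ = M := mul_one M
  · rw [indicator_of_notMem hx]
    rw [mem_Icc, ← abs_le, not_le] at hx
    simp [hh _ (one_lt_sqrt_sq_add_sq_left hx).le]

theorem integrable_indicator_Icc_const (M : ℝ) :
    Integrable ((Icc (-1 : ℝ) 1).indicator fun _ ↦ M) :=
  (integrable_indicator_iff measurableSet_Icc).2 (by simp)

theorem hasDerivAt_integral_radial (hV : ContDiff ℝ 1 V) (hVsupp : ∀ r, 1 ≤ r → V r = 0)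
    (b : ℝ) :
    HasDerivAt (fun b : ℝ ↦ ∫ x : ℝ, (V √(x ^ 2 + b ^ 2) : ℂ))
      (∫ x : ℝ, ((deriv V √(x ^ 2 + b ^ 2) * (b / √(x ^ 2 + b ^ 2)) : ℝ) : ℂ)) b := by
  have hd : Differentiable ℝ V := hV.differentiable one_ne_zero
  have hc : Continuous (deriv V) := hV.continuous_deriv le_rfl
  obtain ⟨M, hM⟩ := (isCompact_Icc (a := (0 : ℝ)) (b := 1)).exists_bound_of_continuousOn
    hc.continuousOn
  refine (hasDerivAt_integral_of_dominated_loc_of_deriv_le (s := univ)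
    (F := fun b x : ℝ ↦ (V √(x ^ 2 + b ^ 2) : ℂ))
    (F' := fun b x : ℝ ↦ ((deriv V √(x ^ 2 + b ^ 2) * (b / √(x ^ 2 + b ^ 2)) : ℝ) : ℂ))
    (bound := (Icc (-1 : ℝ) 1).indicator fun _ ↦ M) Filter.univ_mem
    (.of_forall fun b ↦ (integrable_radial_line hV.continuous hVsupp b).aestronglyMeasurable)
    (integrable_radial_line hV.continuous hVsupp b) ?_
    (.of_forall fun x b _ ↦ (Complex.norm_real _).trans_le <| norm_radial_deriv_le
      (fun r hr ↦ deriv_eq_zero_of_forall_ge_eq_zero hd hVsupp hr) hM x b)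
    (integrable_indicator_Icc_const M) ?_).2
  · exact Measurable.aestronglyMeasurable (by fun_prop)
  · filter_upwards [Measure.ae_ne volume (0 : ℝ)] with x hx b _
    have hpos : 0 < x ^ 2 + b ^ 2 := by positivity
    have h1 := (((hasDerivAt_pow 2 b).const_add (x ^ 2)).sqrt hpos.ne')
    have h2 := ((hd _).hasDerivAt.comp b h1).ofReal_comp
    refine h2.congr_deriv ?_
    congr 2
    have := Real.sqrt_pos.2 hpos
    field_simp
    simp

theorem exists_norm_integral_radial_deriv_le {h : ℝ → ℝ} (hc : Continuous h)
    (hh : ∀ r, 1 ≤ r → h r = 0) :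
    ∃ C, ∀ b, ‖∫ x : ℝ, h √(x ^ 2 + b ^ 2) * (b / √(x ^ 2 + b ^ 2))‖ ≤ C := by
  obtain ⟨M, hM⟩ := (isCompact_Icc (a := (0 : ℝ)) (b := 1)).exists_bound_of_continuousOn
    hc.continuousOn
  refine ⟨_, fun b ↦ norm_integral_le_of_norm_le (integrable_indicator_Icc_const M)
    (.of_forall fun x ↦ ?_)⟩
  exact norm_radial_deriv_le hh hM x b

end RadialSlice

end Auxiliary

open MeasureTheory in
/-- The explicit diffusion constant `ζ` of the paper coincides with the
Dürr–Goldstein–Lebowitz formula `2π²ρ ∫ k² ‖𝓕W((0,k))‖² dk`, where `W(y) = V(‖y‖)`. -/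
theorem diffusion_constant_formulas_agree (V : ℝ → ℝ) (hV : ContDiff ℝ 1 V)
    (hVsupp : ∀ r : ℝ, 1 ≤ r → V r = 0) (hV'0 : deriv V 0 = 0)
    (ρ : ℝ) (hρ : 0 < ρ) :
    (ρ / 2) * ∫ b in (-1:ℝ)..1,
        (2 * ∫ u in |b|..1, deriv V (|b| / u) * (b / u) / Real.sqrt (1 - u^2))^2
      = 2 * Real.pi^2 * ρ *
        ∫ k : ℝ, k^2 *
          ‖𝓕 (fun y : EuclideanSpace ℝ (Fin 2) => (V ‖y‖ : ℂ)) (vec2 0 k)‖^2 := by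
  have hd : Differentiable ℝ V := hV.differentiable one_ne_zero
  have hh (r : ℝ) (hr : 1 ≤ r) : deriv V r = 0 :=
    deriv_eq_zero_of_forall_ge_eq_zero hd hVsupp hr
  set P : ℝ → ℂ := fun b ↦ ∫ x : ℝ, (V √(x ^ 2 + b ^ 2) : ℂ) with hP
  set G : ℝ → ℝ := fun b ↦ ∫ x : ℝ, deriv V √(x ^ 2 + b ^ 2) * (b / √(x ^ 2 + b ^ 2)) with hG
  have hPd (b : ℝ) : HasDerivAt P (G b : ℂ) b := by
    have := hasDerivAt_integral_radial hV hVsupp b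
    rwa [integral_complex_ofReal] at this
  have hderiv : deriv P = fun b ↦ (G b : ℂ) := funext fun b ↦ (hPd b).deriv
  have hG0 {b : ℝ} (hb : b ∉ Set.Icc (-1 : ℝ) 1) : G b = 0 := by
    have hb' : 1 < |b| := by rwa [Set.mem_Icc, ← abs_le, not_le] at hb
    simp [hG, fun x : ℝ ↦ hh √(x ^ 2 + b ^ 2) (one_lt_sqrt_sq_add_sq_right hb').le]
  have hPint : Integrable P := by
    refine Continuous.integrable_of_hasCompactSupport
      (Differentiable.continuous fun b ↦ (hPd b).differentiableAt) ?_
    refine HasCompactSupport.intro (isCompact_Icc (a := (-1 : ℝ)) (b := 1)) fun b hb ↦ ?_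
    have hb' : 1 < |b| := by rwa [Set.mem_Icc, ← abs_le, not_le] at hb
    simp [hP, fun x : ℝ ↦ hVsupp √(x ^ 2 + b ^ 2) (one_lt_sqrt_sq_add_sq_right hb').le]
  obtain ⟨C, hC⟩ := exists_norm_integral_radial_deriv_le (hV.continuous_deriv le_rfl) hh
  have hmem (p : ENNReal) : MemLp (deriv P) p := by
    refine (memLp_indicator_const p (measurableSet_Icc (a := (-1 : ℝ)) (b := 1)) C
      (.inr (by simp))).mono (measurable_deriv P).aestronglyMeasurable (.of_forall fun b ↦ ?_)
    rw [hderiv]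
    by_cases hb : b ∈ Set.Icc (-1 : ℝ) 1
    · rw [Set.indicator_of_mem hb, Complex.norm_real]
      exact (hC b).trans (le_abs_self C)
    · simp [hG0 hb]
  have hint : Integrable (deriv P) := memLp_one_iff_integrable.1 (hmem 1)
  have hfourier (k : ℝ) : k ^ 2 *
      ‖𝓕 (fun y : EuclideanSpace ℝ (Fin 2) => (V ‖y‖ : ℂ)) (vec2 0 k)‖ ^ 2
        = (4 * Real.pi ^ 2)⁻¹ * ‖𝓕 (deriv P) k‖ ^ 2 := by
    rw [fourier_vec2_zero (integrable_radial hV.continuous hVsupp)]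
    simp only [norm_vec2]
    rw [Real.fourier_deriv hPint (fun b ↦ (hPd b).differentiableAt) hint]
    simp only [norm_smul, norm_mul, Complex.norm_real, Complex.norm_I, Complex.norm_ofNat,
      mul_pow, Real.norm_eq_abs, sq_abs]
    field_simp
    ring
  have hinner (b : ℝ) (hb : b ≠ 0) (hb1 : |b| ≤ 1) :
      2 * ∫ u in |b|..1, deriv V (|b| / u) * (b / u) / Real.sqrt (1 - u ^ 2) = G b := by
    rw [integral_abs_div_substitution hh hb hb1,
      ← integral_comp_abs (f := fun x ↦ deriv V √(x ^ 2 + b ^ 2) * (b / √(x ^ 2 + b ^ 2)))]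
    simp [hG]
  have hleft : ∫ b in (-1 : ℝ)..1,
      (2 * ∫ u in |b|..1, deriv V (|b| / u) * (b / u) / Real.sqrt (1 - u ^ 2)) ^ 2
        = ∫ b, ‖deriv P b‖ ^ 2 := by
    rw [intervalIntegral.integral_of_le (by norm_num), ← integral_Icc_eq_integral_Ioc,
      ← setIntegral_eq_integral_of_forall_compl_eq_zero (s := Set.Icc (-1 : ℝ) 1)
        (f := fun b ↦ ‖deriv P b‖ ^ 2) fun b hb ↦ by simp [hderiv, hG0 hb]]
    refine setIntegral_congr_ae measurableSet_Icc ?_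
    filter_upwards [Measure.ae_ne volume (0 : ℝ)] with b hb hb1
    rw [hinner b hb (abs_le.2 hb1), hderiv, Complex.norm_real,
      Real.norm_eq_abs, sq_abs]
  simp_rw [hfourier]
  rw [hleft, integral_const_mul, hint.integral_norm_sq_fourier (hmem 2)]
  field_simp
  ring
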